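/- Let G be a finite connected simple graph with maximum degree Δ ≥ 3 that is not complete, let s ≥ 2, and let p_1, ..., p_s be non-negative integers with p_1 + ⋯ + p_s ≥ Δ − s. Then the vertex set of G can be partitioned into sets V_1, ..., V_s such that for each i ∈ {1, ..., s} the induced subgraph G[V_i] is p_i-degenerate. -/

import Mathlib

/-- `G[A]` is `d`-degenerate: every non-empty subgraph of the subgraph of `G`
induced by `A` contains a vertex of degree at most `d`.  Equivalently, every
non-empty `B ⊆ A` contains a vertex having at most `d` neighbors inside `B`. -/
def DegenerateOn {V : Type*} [DecidableEq V] (G : SimpleGraph V) [DecidableRel G.Adj]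
    (A : Finset V) (d : ℕ) : Prop :=
  ∀ B : Finset V, B ⊆ A → B.Nonempty → ∃ v ∈ B, (B.filter (fun u => G.Adj v u)).card ≤ d

namespace DegeneratePartition

variable {V : Type*} {G : SimpleGraph V}

variable (G) in
/-- The spanning subgraph of `G` whose edges are those with both ends in `M`. -/
def within (M : Finset V) : SimpleGraph V where
  Adj a b := G.Adj a b ∧ a ∈ M ∧ b ∈ M
  symm := ⟨fun _ _ h => ⟨h.1.symm, h.2.2, h.2.1⟩⟩
  loopless := ⟨fun _ h => G.loopless.irrefl _ h.1⟩

lemma within_mono {A B : Finset V} (h : A ⊆ B) : within G A ≤ within G B :=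
  fun _ _ hab => ⟨hab.1, h hab.2.1, h hab.2.2⟩

lemma within_reachable_of_adj {M : Finset V} {a b : V} (h : G.Adj a b) (ha : a ∈ M) (hb : b ∈ M) :
    (within G M).Reachable a b :=
  SimpleGraph.Adj.reachable (G := within G M) ⟨h, ha, hb⟩

/-- A property of `a` that is stable under passing to neighbors in `M` holds on the
whole component of `a` in `G[M]`. -/
lemma within_reachable_induction {M : Finset V} {a b : V} (h : (within G M).Reachable a b)
    {C : V → Prop} (ha : C a) (hstep : ∀ x y, C x → G.Adj x y → x ∈ M → y ∈ M → C y) : C b := by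
  obtain ⟨w⟩ := h
  induction w with
  | nil => exact ha
  | cons hadj _ ih => exact ih (hstep _ _ ha hadj.1 hadj.2.1 hadj.2.2)

lemma mem_of_within_reachable {M : Finset V} {a b : V} (h : (within G M).Reachable a b)
    (ha : a ∈ M) : b ∈ M :=
  within_reachable_induction (C := fun x => x ∈ M) h ha fun _ _ _ _ _ hy => hy

section

variable [DecidableRel G.Adj]

variable (G) in
/-- The number of neighbors of `v` in `A`. -/
def degOn (A : Finset V) (v : V) : ℕ := (A.filter (fun u => G.Adj v u)).card

lemma degOn_mono {A B : Finset V} (h : A ⊆ B) (v : V) : degOn G A v ≤ degOn G B v :=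
  Finset.card_le_card (Finset.filter_subset_filter _ h)

end

variable [DecidableEq V]

/-- A component of `G[M]` in which `v` is not isolated has a vertex other than `v` that is not
a cut vertex, and which is adjacent to `v` only if `v` dominates the component. -/
lemma exists_far_vertex {M : Finset V} {v w : V} (hvM : v ∈ M) (hwM : w ∈ M) (hvw : G.Adj v w) :
    ∃ x, x ≠ v ∧ (within G M).Reachable v x ∧
      (∀ y, (within G M).Reachable v y → y ≠ x → (within G (M.erase x)).Reachable v y) ∧
      (G.Adj v x → ∀ y, (within G M).Reachable v y → y ≠ v → G.Adj v y) := by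
  classical
  have hne : (M.filter (fun y => (within G M).Reachable v y)).Nonempty :=
    ⟨v, by simp [hvM]⟩
  obtain ⟨x, hx, hmax⟩ := Finset.exists_max_image _ (fun y => (within G M).dist v y) hne
  have hmax' : ∀ y, (within G M).Reachable v y → (within G M).dist v y ≤ (within G M).dist v x :=
    fun y hy => hmax y (Finset.mem_filter.2 ⟨mem_of_within_reachable hy hvM, hy⟩)
  have hvx := (Finset.mem_filter.1 hx).2
  have hxv : x ≠ v := by
    rintro rfl
    have h1 := hmax' w (within_reachable_of_adj hvw hvM hwM)
    rw [SimpleGraph.dist_self, Nat.le_zero, (within_reachable_of_adj hvw hvM hwM).dist_eq_zero_iff]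
      at h1
    exact hvw.ne h1
  refine ⟨x, hxv, hvx, ?_, ?_⟩
  · suffices h : ∀ n y, (within G M).Reachable v y → (within G M).dist v y ≤ n → y ≠ x →
        (within G (M.erase x)).Reachable v y from fun y hy hyx => h _ y hy le_rfl hyx
    intro n
    induction n with
    | zero =>
      intro y hy hd _
      rw [Nat.le_zero, hy.dist_eq_zero_iff] at hd
      rw [hd]
    | succ n ih =>
      intro y hy hd hyx
      obtain ⟨q, hq⟩ := hy.symm.exists_walk_length_eq_dist
      have hdy := hmax' y hy
      rw [SimpleGraph.dist_comm] at hq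
      cases q with
      | nil => rfl
      | @cons _ z _ hadj q =>
        have hzv : (within G M).Reachable v z := q.reachable.symm
        have hzy : (within G M).dist v z < (within G M).dist v y := by
          rw [← hq, SimpleGraph.dist_comm, SimpleGraph.Walk.length_cons]
          exact Nat.lt_succ_of_le (SimpleGraph.dist_le q)
        have hzx : z ≠ x := by
          rintro rfl
          omega
        exact (ih z hzv (by omega) hzx).trans (within_reachable_of_adj hadj.1.symm
          (Finset.mem_erase.2 ⟨hzx, hadj.2.2⟩) (Finset.mem_erase.2 ⟨hyx, hadj.2.1⟩))
  · intro hadj y hy hyv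
    have h1 : (within G M).dist v x = 1 :=
      SimpleGraph.dist_eq_one_iff_adj.2 ⟨hadj, hvM, (Finset.mem_filter.1 hx).1⟩
    have h2 := hmax' y hy
    have h3 := hy.pos_dist_of_ne hyv.symm
    exact (SimpleGraph.dist_eq_one_iff_adj.1 (by omega : (within G M).dist v y = 1)).1

variable [DecidableRel G.Adj]

lemma degOn_insert {A : Finset V} {x : V} (hx : x ∉ A) (v : V) :
    degOn G (insert x A) v = degOn G A v + if G.Adj v x then 1 else 0 := by
  unfold degOn
  rw [Finset.filter_insert]
  split_ifs with h
  · rw [Finset.card_insert_of_notMem (by simp [hx])]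
  · rfl

lemma degOn_eq_erase {A : Finset V} {x : V} (hx : x ∈ A) (v : V) :
    degOn G A v = degOn G (A.erase x) v + if G.Adj v x then 1 else 0 := by
  rw [← degOn_insert (Finset.notMem_erase x A), Finset.insert_erase hx]

lemma degOn_erase_self (A : Finset V) (v : V) : degOn G (A.erase v) v = degOn G A v := by
  by_cases hv : v ∈ A
  · simp [degOn_eq_erase hv]
  · rw [Finset.erase_eq_of_notMem hv]

lemma degOn_add_degOn_compl [Fintype V] (A : Finset V) (v : V) :
    degOn G A v + degOn G Aᶜ v = G.degree v := by
  unfold degOn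
  rw [← Finset.card_union_of_disjoint
    (Finset.disjoint_filter_filter (disjoint_compl_right (a := A))), ← Finset.filter_union,
    Finset.union_compl, ← SimpleGraph.card_neighborFinset_eq_degree,
    SimpleGraph.neighborFinset_eq_filter]

lemma _root_.DegenerateOn.mono {A B : Finset V} {d : ℕ} (h : DegenerateOn G B d) (hAB : A ⊆ B) :
    DegenerateOn G A d :=
  fun C hC hne => h C (hC.trans hAB) hne

lemma _root_.DegenerateOn.insert {A : Finset V} {d : ℕ} (h : DegenerateOn G A d) {v : V}
    (hv : degOn G A v ≤ d) : DegenerateOn G (insert v A) d := by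
  intro B hB hne
  by_cases hvB : v ∈ B
  · refine ⟨v, hvB, ?_⟩
    change degOn G B v ≤ d
    rw [← degOn_erase_self]
    exact (degOn_mono (Finset.subset_insert_iff.1 hB) v).trans hv
  · exact h B ((Finset.subset_insert_iff_of_notMem hvB).1 hB) hne

/-- A `d`-degenerate set splits greedily into `p i`-degenerate sets, for `i` in `J`, as soon as
`d < ∑ i ∈ J, (p i + 1)`. -/
lemma _root_.DegenerateOn.exists_split {ι : Type*} [DecidableEq ι] (p : ι → ℕ) (J : Finset ι)
    {d : ℕ} (hd : d < ∑ i ∈ J, (p i + 1)) (A : Finset V) (hA : DegenerateOn G A d) :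
    ∃ c : V → ι, (∀ v ∈ A, c v ∈ J) ∧
      ∀ i, DegenerateOn G (A.filter (fun v => c v = i)) (p i) := by
  induction hn : A.card generalizing A with
  | zero =>
    obtain ⟨i, -, -⟩ := Finset.exists_ne_zero_of_sum_ne_zero (Nat.ne_zero_of_lt hd)
    rw [Finset.card_eq_zero] at hn
    subst hn
    refine ⟨fun _ => i, by simp, fun j B hB hne => ?_⟩
    simp only [Finset.filter_empty, Finset.subset_empty] at hB
    simp [hB] at hne
  | succ n ih =>
    obtain ⟨v, hvA, hv⟩ := hA A subset_rfl (Finset.card_pos.1 (by omega))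
    obtain ⟨c, hcJ, hc⟩ := ih (A.erase v) (hA.mono (Finset.erase_subset v A))
      (by rw [Finset.card_erase_of_mem hvA]; omega)
    obtain ⟨i, hiJ, hi⟩ : ∃ i ∈ J, degOn G ((A.erase v).filter (fun u => c u = i)) v < p i + 1 := by
      refine Finset.exists_lt_of_sum_lt (lt_of_le_of_lt ?_ hd)
      refine le_trans ?_ hv
      have hmaps : Set.MapsTo c ((A.erase v).filter (fun u => G.Adj v u)) J := by
        intro u hu
        exact hcJ u (Finset.mem_filter.1 hu).1
      rw [← degOn, ← degOn_erase_self, degOn, Finset.card_eq_sum_card_fiberwise hmaps]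
      refine Finset.sum_le_sum fun i _ => ?_
      rw [degOn, Finset.filter_filter, Finset.filter_filter]
      simp only [and_comm, le_refl]
    refine ⟨Function.update c v i, fun u hu => ?_, fun j => ?_⟩
    · by_cases huv : u = v
      · subst huv; simpa using hiJ
      · rw [Function.update_of_ne huv]
        exact hcJ u (Finset.mem_erase.2 ⟨huv, hu⟩)
    · by_cases hj : j = i
      · subst hj
        refine ((hc j).insert (Nat.lt_succ_iff.1 hi)).mono fun u hu => ?_
        by_cases huv : u = v
        · simp [huv]
        · simpa [huv] using hu
      · refine (hc j).mono fun u hu => ?_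
        by_cases huv : u = v
        · subst huv
          simp [Ne.symm hj] at hu
        · simpa [huv] using hu

section Hole

variable [Fintype V]

variable (G) in
/-- `G` has maximum degree at most `p + q + 2`, and its vertices cannot be partitioned into a
`p`-degenerate and a `q`-degenerate set. -/
structure Obstructed (p q : ℕ) : Prop where
  degree_le : ∀ v, G.degree v ≤ p + q + 2
  no_partition : ∀ A : Finset V, DegenerateOn G A p → ¬ DegenerateOn G Aᶜ q

lemma Obstructed.symm {p q : ℕ} (h : Obstructed G p q) : Obstructed G q p :=
  ⟨fun v => by have := h.degree_le v; omega,
    fun A hA hA' => h.no_partition Aᶜ hA' (by rwa [compl_compl])⟩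

variable (G) in
/-- Removing the vertex `v` of `M` leaves a `p`-degenerate set, and the complement of `M` is
`q`-degenerate. -/
structure IsHole (p q : ℕ) (M : Finset V) (v : V) : Prop where
  mem : v ∈ M
  erase : DegenerateOn G (M.erase v) p
  compl : DegenerateOn G Mᶜ q

lemma compl_insert_compl {M : Finset V} {v : V} : (insert v Mᶜ)ᶜ = M.erase v := by
  rw [Finset.compl_insert, compl_compl]

lemma erase_insert_compl {M : Finset V} {v : V} (hv : v ∈ M) : (insert v Mᶜ).erase v = Mᶜ :=
  Finset.erase_insert (by simpa using hv)

variable {p q : ℕ} {M : Finset V} {v x y z : V}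

lemma IsHole.flip (h : IsHole G p q M v) : IsHole G q p (insert v Mᶜ) v where
  mem := Finset.mem_insert_self _ _
  erase := by rw [erase_insert_compl h.mem]; exact h.compl
  compl := by rw [compl_insert_compl]; exact h.erase

lemma IsHole.degOn_eq (h : IsHole G p q M v) (hG : Obstructed G p q) : degOn G M v = p + 1 := by
  have h1 : p < degOn G M v := by
    by_contra! hlt
    rw [← degOn_erase_self] at hlt
    have := h.erase.insert hlt
    rw [Finset.insert_erase h.mem] at this
    exact hG.no_partition M this h.compl
  have h2 : q < degOn G Mᶜ v := by
    by_contra! hlt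
    exact hG.symm.no_partition _ (h.compl.insert hlt) (by rw [compl_insert_compl]; exact h.erase)
  have h3 := degOn_add_degOn_compl (G := G) M v
  have h4 := hG.degree_le v
  omega

lemma IsHole.of_adj (h : IsHole G p q M v) (hG : Obstructed G p q) (hx : x ∈ M)
    (hvx : G.Adj v x) : IsHole G p q M x where
  mem := hx
  erase := by
    have h1 : M.erase x = insert v ((M.erase v).erase x) := by
      rw [Finset.erase_right_comm, Finset.insert_erase (Finset.mem_erase.2 ⟨hvx.ne, h.mem⟩)]
    have h2 : degOn G ((M.erase v).erase x) v ≤ p := by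
      have := degOn_eq_erase (G := G) hx v
      rw [h.degOn_eq hG, if_pos hvx] at this
      rw [Finset.erase_right_comm, degOn_erase_self]
      omega
    rw [h1]
    exact (h.erase.mono (Finset.erase_subset _ _)).insert h2
  compl := h.compl

lemma IsHole.of_reachable (h : IsHole G p q M v) (hG : Obstructed G p q)
    (hx : (within G M).Reachable v x) : IsHole G p q M x :=
  within_reachable_induction (C := IsHole G p q M) hx h
    fun _ _ ha hab _ hb => ha.of_adj hG hb hab

lemma IsHole.degOn_eq_of_reachable (h : IsHole G p q M v) (hG : Obstructed G p q)
    (hx : (within G M).Reachable v x) : degOn G M x = p + 1 :=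
  (h.of_reachable hG hx).degOn_eq hG

lemma IsHole.adj_iff_of_reachable (h : IsHole G p q M v) (hG : Obstructed G p q)
    (hx : (within G M).Reachable v x)
    (hvy : (within G (insert v Mᶜ)).Reachable v y)
    (hxy : (within G (insert x Mᶜ)).Reachable x y) : G.Adj y v ↔ G.Adj y x := by
  have h1 := h.flip.degOn_eq_of_reachable hG.symm hvy
  have h2 := (h.of_reachable hG hx).flip.degOn_eq_of_reachable hG.symm hxy
  rw [degOn_insert (by simpa using h.mem)] at h1
  rw [degOn_insert (by simpa using mem_of_within_reachable hx h.mem)] at h2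
  split_ifs at h1 h2 <;> first | omega | simp_all

variable (G) in
/-- What is left of a component `D ∪ {u}` of `G[A ∪ {u}]`, regular of degree `p + 1`, after
removing its non-cut vertex `u`. -/
structure Remnant (p : ℕ) (A D : Finset V) (u : V) : Prop where
  subset : D ⊆ A
  connected : ∀ a ∈ D, ∀ b ∈ D, (within G D).Reachable a b
  degOn_eq : ∀ d ∈ D, degOn G A d + (if G.Adj d u then 1 else 0) = p + 1
  lt_degOn : p < degOn G D u
  closed : ∀ d ∈ D, ∀ a ∈ A, G.Adj d a → a ∈ D

variable {A D : Finset V} {u : V}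

/-- A hole `v` adjacent to a remnant has the same neighbors in it as the vertex that left it. -/
lemma Remnant.adj_iff (hD : Remnant G p (M.erase v) D u) (h : IsHole G p q M v)
    (hG : Obstructed G p q) (hxD : x ∈ D) (hvx : G.Adj v x) (hy : y ∈ D) :
    G.Adj y v ↔ G.Adj y u := by
  have h1 := h.degOn_eq_of_reachable hG ((within_reachable_of_adj hvx h.mem
    (Finset.mem_of_mem_erase (hD.subset hxD))).trans
      ((hD.connected x hxD y hy).mono
        (within_mono (hD.subset.trans (Finset.erase_subset v M)))))
  have h2 := hD.degOn_eq y hy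
  rw [degOn_eq_erase h.mem] at h1
  split_ifs at h1 h2 <;> first | omega | simp_all

/-- A connected graph of maximum degree at most `n` with a clique on more than `n` vertices
is complete. -/
lemma eq_top_of_isClique (hconn : G.Connected) {n : ℕ} (hdeg : ∀ v, G.degree v ≤ n) {U : Finset V}
    (hU : n < U.card) (hcl : ∀ a ∈ U, ∀ b ∈ U, a ≠ b → G.Adj a b) : G = ⊤ := by
  have hnbr : ∀ a ∈ U, ∀ b, G.Adj a b → b ∈ U := by
    intro a ha b hab
    have hsub : U.erase a ⊆ G.neighborFinset a := fun c hc => by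
      rw [Finset.mem_erase] at hc
      simpa using hcl a ha c hc.2 hc.1.symm
    have heq : U.erase a = G.neighborFinset a := Finset.eq_of_subset_of_card_le hsub (by
      rw [Finset.card_erase_of_mem ha, SimpleGraph.card_neighborFinset_eq_degree]
      have := hdeg a
      omega)
    have : b ∈ U.erase a := by rw [heq]; simpa using hab
    exact Finset.mem_of_mem_erase this
  obtain ⟨a, ha⟩ := Finset.card_pos.1 (Nat.zero_lt_of_lt hU)
  have hall : ∀ b, b ∈ U := by
    intro b
    obtain ⟨w⟩ := hconn.preconnected a b
    induction w with
    | nil => exact ha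
    | cons hadj _ ih => exact ih (hnbr _ ha _ hadj)
  ext a b
  exact ⟨fun h => h.ne, fun h => hcl a (hall a) b (hall b) h⟩

/-- If the hole `v` dominates its component on the side of `M`, is not a cut vertex of its component
on the other side, and an edge joins the two components away from `v`, then `G` is complete. -/
lemma IsHole.eq_top (h : IsHole G p q M v) (hG : Obstructed G p q) (hconn : G.Connected)
    (hD : Remnant G q Mᶜ D v)
    (hdom : ∀ y, (within G M).Reachable v y → y ≠ v → G.Adj v y)
    (hx : (within G M).Reachable v x) (hxv : x ≠ v) (hz : z ∈ D) (hxz : G.Adj x z) : G = ⊤ := by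
  set T := insert v (M.filter (fun y => G.Adj v y)) with hT
  set S := D.filter (fun y => G.Adj v y) with hS
  have hTcard : T.card = p + 2 := by
    rw [hT, Finset.card_insert_of_notMem (by simp)]
    have := h.degOn_eq hG
    rw [degOn] at this
    omega
  have hScard : q + 1 ≤ S.card := hD.lt_degOn
  have hTreach : ∀ y ∈ T, (within G M).Reachable v y := by
    intro y hy
    rw [hT, Finset.mem_insert, Finset.mem_filter] at hy
    obtain rfl | hy := hy
    · exact SimpleGraph.Reachable.refl _
    · exact within_reachable_of_adj hy.2 h.mem hy.1
  have hreachT : ∀ y, (within G M).Reachable v y → y ∈ T := by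
    intro y hy
    by_cases hyv : y = v
    · simp [hT, hyv]
    · exact Finset.mem_insert_of_mem (Finset.mem_filter.2
        ⟨mem_of_within_reachable hy h.mem, hdom y hy hyv⟩)
  have hTT : ∀ a ∈ T, ∀ b ∈ T, a ≠ b → G.Adj a b := by
    intro a ha b hb hab
    have haM := mem_of_within_reachable (hTreach a ha) h.mem
    have hsub : M.filter (fun y => G.Adj a y) ⊆ T.erase a := by
      intro y hy
      rw [Finset.mem_filter] at hy
      exact Finset.mem_erase.2 ⟨hy.2.ne', hreachT y ((hTreach a ha).trans
        (within_reachable_of_adj hy.2 haM hy.1))⟩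
    have heq := Finset.eq_of_subset_of_card_le hsub (by
      have := h.degOn_eq_of_reachable hG (hTreach a ha)
      rw [degOn] at this
      rw [Finset.card_erase_of_mem ha]
      omega)
    have hb' : b ∈ T.erase a := Finset.mem_erase.2 ⟨hab.symm, hb⟩
    rw [← heq, Finset.mem_filter] at hb'
    exact hb'.2
  have hxM := mem_of_within_reachable hx h.mem
  have hvx := hdom x hx hxv
  have hDM : D ⊆ insert v Mᶜ := hD.subset.trans (Finset.subset_insert _ _)
  have hxS : ∀ d ∈ D, G.Adj d v ↔ G.Adj d x := by
    intro d hd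
    have hxflip := (h.of_reachable hG hx).flip
    have hD' : Remnant G q ((insert x Mᶜ).erase x) D v := by rwa [erase_insert_compl hxM]
    exact (hD'.adj_iff hxflip hG.symm hz hxz hd).symm
  have hST : ∀ d ∈ S, ∀ y ∈ T, G.Adj d y := by
    intro d hd y hy
    rw [hS, Finset.mem_filter] at hd
    by_cases hyv : y = v
    · rw [hyv]; exact hd.2.symm
    have hdflip := (h.flip.of_adj hG.symm (hDM hd.1) hd.2).flip
    rw [compl_insert_compl] at hdflip
    have hdx : G.Adj d x := (hxS d hd.1).1 hd.2.symm
    have hdM : d ∉ M := by simpa using hD.subset hd.1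
    have hxm : x ∈ M.erase v := Finset.mem_erase.2 ⟨hxv, hxM⟩
    have hyM := mem_of_within_reachable (hTreach y hy) h.mem
    have hym : y ∈ M.erase v := Finset.mem_erase.2 ⟨hyv, hyM⟩
    have hreach : (within G (insert d (M.erase v))).Reachable d y := by
      refine (within_reachable_of_adj hdx hdflip.mem (Finset.mem_insert_of_mem hxm)).trans ?_
      by_cases hxy : x = y
      · rw [hxy]
      · exact within_reachable_of_adj (hTT x (hreachT x hx) y hy hxy)
          (Finset.mem_insert_of_mem hxm) (Finset.mem_insert_of_mem hym)
    have h1 := hdflip.degOn_eq_of_reachable hG hreach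
    have h2 := h.degOn_eq_of_reachable hG (hTreach y hy)
    rw [degOn_insert (by simp [hdM])] at h1
    rw [degOn_eq_erase h.mem, if_pos (hdom y (hTreach y hy) hyv).symm] at h2
    split_ifs at h1 with hyd
    · exact hyd.symm
    · omega
  have hSS : ∀ a ∈ S, ∀ b ∈ S, a ≠ b → G.Adj a b := by
    intro a ha b hb hab
    have haD := (Finset.mem_filter.1 ha).1
    have hbD := (Finset.mem_filter.1 hb).1
    have hav := (Finset.mem_filter.1 ha).2
    have hbv := (Finset.mem_filter.1 hb).2
    have haM : a ∉ M := by simpa using hD.subset haD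
    have hbM : b ∉ M := by simpa using hD.subset hbD
    have haflip := (h.flip.of_adj hG.symm (hDM haD) hav).flip
    rw [compl_insert_compl] at haflip
    have hxm : x ∈ M.erase v := Finset.mem_erase.2 ⟨hxv, hxM⟩
    have hcompl : (insert a (M.erase v))ᶜ = (insert v Mᶜ).erase a := by
      rw [Finset.compl_insert, Finset.compl_erase]
    have hxT := hreachT x hx
    have key := haflip.adj_iff_of_reachable (x := x) (y := b) hG
      (within_reachable_of_adj (hST a ha x hxT) haflip.mem (Finset.mem_insert_of_mem hxm))
      (by
        rw [hcompl, Finset.insert_erase (hDM haD)]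
        exact (within_reachable_of_adj hav.symm (hDM haD) h.flip.mem).trans
          (within_reachable_of_adj hbv h.flip.mem (hDM hbD)))
      (by
        rw [hcompl]
        exact within_reachable_of_adj (hST b hb x hxT).symm (Finset.mem_insert_self _ _)
          (Finset.mem_insert_of_mem (Finset.mem_erase.2 ⟨hab.symm, hDM hbD⟩)))
    exact (key.2 (hST b hb x hxT)).symm
  have hdisj : Disjoint T S := by
    rw [Finset.disjoint_left]
    intro a haT haS
    exact Finset.mem_compl.1 (hD.subset (Finset.mem_filter.1 haS).1)
      (mem_of_within_reachable (hTreach a haT) h.mem)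
  refine eq_top_of_isClique hconn hG.degree_le (U := T ∪ S) ?_ ?_
  · rw [Finset.card_union_of_disjoint hdisj]
    omega
  · intro a ha b hb hab
    rw [Finset.mem_union] at ha hb
    rcases ha with ha | ha <;> rcases hb with hb | hb
    · exact hTT a ha b hb hab
    · exact (hST b hb a ha).symm
    · exact hST a ha b hb
    · exact hSS a ha b hb hab

variable (G) in
/-- The vertex `u` that left the remnant `D` lies in the remnant `D'`. If it was adjacent to the
vertex `u'` that left `D'`, then it dominates `D'`, and `D` is joined to `D'` only through `u`. -/
structure Linked (D : Finset V) (u : V) (D' : Finset V) (u' : V) : Prop where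
  mem : u ∈ D'
  adj : G.Adj u u' → ∀ d ∈ D', d ≠ u → G.Adj d u ∧ ∀ e ∈ D, ¬ G.Adj d e

variable (G) in
/-- The history of a hole that wandered to `v`: `P` and `R` list the remnants it left behind on the
side of `M` and on the other side. -/
structure Trail (p q : ℕ) (M : Finset V) (v : V) (P R : Finset V → V → Prop) : Prop where
  hole : IsHole G p q M v
  remnant_left : ∀ D u, P D u → Remnant G p (M.erase v) D u
  remnant_right : ∀ D u, R D u → Remnant G q Mᶜ D u
  linked_left : ∀ D u, P D u → ∃ D' u', R D' u' ∧ Linked G D u D' u'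
  linked_right : ∀ D u, R D u → u = v ∨ ∃ D' u', P D' u' ∧ Linked G D u D' u'

variable {P R : Finset V → V → Prop}

/-- In an incomplete graph, the hole is never adjacent to an old remnant on its own side. -/
lemma Trail.not_adj (t : Trail G p q M v P R) (hG : Obstructed G p q) (hconn : G.Connected)
    (hpq : 1 ≤ p + q) (hne : G ≠ ⊤) (hD : P D u) (hz : z ∈ D) : ¬ G.Adj v z := by
  intro hvz
  have h := t.hole
  have hDr := t.remnant_left D u hD
  obtain ⟨D', u', hD', hlink⟩ := t.linked_left D u hD
  have hDr' := t.remnant_right D' u' hD'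
  have hDM : D ⊆ M := hDr.subset.trans (Finset.erase_subset _ _)
  have hiff : ∀ d ∈ D, G.Adj d v ↔ G.Adj d u := fun d hd => hDr.adj_iff h hG hz hvz hd
  have hzu : G.Adj z u := (hiff z hz).1 hvz.symm
  have hzM : z ∈ M := hDM hz
  have huM : u ∈ Mᶜ := hDr'.subset hlink.mem
  have hzhole : IsHole G p q M z := h.of_adj hG hzM hvz
  have hiff' : ∀ d ∈ D', G.Adj d z ↔ G.Adj d u' := by
    intro d hd
    have hD'z : Remnant G q ((insert z Mᶜ).erase z) D' u' := by rwa [erase_insert_compl hzM]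
    exact hD'z.adj_iff hzhole.flip hG.symm hlink.mem hzu hd
  have hadj := hlink.adj ((hiff' u hlink.mem).1 hzu.symm)
  have hq : q = 0 := by
    have hsub : D'.filter (fun d => G.Adj u' d) ⊆ {u} := by
      intro d hd
      rw [Finset.mem_filter] at hd
      rw [Finset.mem_singleton]
      by_contra hdu
      exact (hadj d hd.1 hdu).2 z hz ((hiff' d hd.1).2 hd.2.symm)
    have h1 := Finset.card_le_card hsub
    have h2 := hDr'.lt_degOn
    rw [degOn] at h2
    rw [Finset.card_singleton] at h1
    omega
  have hdegu : 1 < (D.filter (fun d => G.Adj u d)).card := by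
    have := hDr.lt_degOn
    rw [degOn] at this
    omega
  obtain ⟨y, hy, hyz⟩ := Finset.exists_mem_ne hdegu z
  rw [Finset.mem_filter] at hy
  have hyv : G.Adj y v := (hiff y hy.1).2 hy.2.symm
  have hyM : y ∈ M := hDM hy.1
  have huv : G.Adj u v := by
    have hzy : (within G M).Reachable z y :=
      (within_reachable_of_adj hvz.symm hzM h.mem).trans
        (within_reachable_of_adj hyv.symm h.mem hyM)
    have hym : y ∈ M.erase z := Finset.mem_erase.2 ⟨hyz, hyM⟩
    have hvm : v ∈ M.erase z := Finset.mem_erase.2 ⟨hvz.ne, h.mem⟩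
    have key := hzhole.flip.adj_iff_of_reachable (x := u) (y := v) hG.symm
      (within_reachable_of_adj hzu (Finset.mem_insert_self _ _) (Finset.mem_insert_of_mem huM))
      (by
        rw [compl_insert_compl, Finset.insert_erase hzM]
        exact within_reachable_of_adj hvz.symm hzM h.mem)
      (by
        rw [compl_insert_compl]
        exact (within_reachable_of_adj hy.2 (Finset.mem_insert_self _ _)
          (Finset.mem_insert_of_mem hym)).trans (within_reachable_of_adj hyv
            (Finset.mem_insert_of_mem hym) (Finset.mem_insert_of_mem hvm)))
    exact (key.1 hvz).symm
  have hDv : Remnant G p (insert v Mᶜ)ᶜ D v := by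
    rw [compl_insert_compl]
    refine ⟨hDr.subset, hDr.connected, fun d hd => ?_, ?_, hDr.closed⟩
    · rw [← hDr.degOn_eq d hd]
      simp only [hiff d hd]
    · have : degOn G D v = degOn G D u := by
        unfold degOn
        congr 1
        exact Finset.filter_congr fun d hd => by rw [G.adj_comm, hiff d hd, G.adj_comm]
      rw [this]
      exact hDr.lt_degOn
  have hone : ∀ {a b c : V}, degOn G (insert v Mᶜ) a = q + 1 → b ∈ insert v Mᶜ →
      c ∈ insert v Mᶜ → G.Adj a b → G.Adj a c → c = b := by
    intro a b c hdeg hb hc hab hac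
    rw [hq, zero_add, degOn, Finset.card_eq_one] at hdeg
    obtain ⟨e, he⟩ := hdeg
    have h1 : b ∈ ({e} : Finset V) := he ▸ Finset.mem_filter.2 ⟨hb, hab⟩
    have h2 : c ∈ ({e} : Finset V) := he ▸ Finset.mem_filter.2 ⟨hc, hac⟩
    rw [Finset.mem_singleton] at h1 h2
    rw [h1, h2]
  have hvN : v ∈ insert v Mᶜ := Finset.mem_insert_self _ _
  have huN : u ∈ insert v Mᶜ := Finset.mem_insert_of_mem huM
  have hvu := within_reachable_of_adj huv.symm hvN huN
  refine hne (h.flip.eq_top hG.symm hconn hDv (x := u) (z := z) ?_ hvu huv.ne hz hzu.symm)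
  intro y hy hyv
  have : y = v ∨ y = u := by
    refine within_reachable_induction (C := fun y => y = v ∨ y = u) hy (Or.inl rfl) ?_
    rintro a b (rfl | rfl) hab - hb
    · exact Or.inr (hone (h.flip.degOn_eq hG.symm) huN hb huv.symm hab)
    · exact Or.inl (hone (h.flip.degOn_eq_of_reachable hG.symm hvu) hvN hb huv hab)
  obtain rfl | rfl := this
  · exact absurd rfl hyv
  · exact huv.symm

/-- The hole can always move on, leaving behind a remnant disjoint from the earlier ones. -/
lemma Trail.exists_extend (t : Trail G p q M v P R) (hG : Obstructed G p q) (hconn : G.Connected)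
    (hpq : 1 ≤ p + q) (hne : G ≠ ⊤) :
    ∃ x D, D.Nonempty ∧ (∀ D' u', P D' u' ∨ R D' u' → Disjoint D D') ∧
      Trail G q p (insert x Mᶜ) x R (fun D' u' => P D' u' ∨ (D' = D ∧ u' = x)) := by
  classical
  have h := t.hole
  obtain ⟨w, hw⟩ : (M.filter (fun y => G.Adj v y)).Nonempty := by
    rw [← Finset.card_pos]
    have := h.degOn_eq hG
    rw [degOn] at this
    omega
  rw [Finset.mem_filter] at hw
  obtain ⟨x, hxv, hvx, hconx, hdom⟩ := exists_far_vertex h.mem hw.1 hw.2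
  have hx : IsHole G p q M x := h.of_reachable hG hvx
  set K := M.filter (fun y => (within G M).Reachable v y) with hK
  have hmemK : ∀ y, y ∈ K ↔ (within G M).Reachable v y := by
    intro y
    rw [hK, Finset.mem_filter, and_iff_right_iff_imp]
    exact fun hy => mem_of_within_reachable hy h.mem
  have hclosed : ∀ a ∈ K, ∀ b ∈ M, G.Adj a b → b ∈ K := fun a ha b hb hab =>
    (hmemK b).2 (((hmemK a).1 ha).trans
      (within_reachable_of_adj hab (Finset.mem_filter.1 ha).1 hb))
  have hKM : K ⊆ M := Finset.filter_subset _ _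
  have hvK : v ∈ K := (hmemK v).2 (SimpleGraph.Reachable.refl _)
  have hxK : x ∈ K := (hmemK x).2 hvx
  have hPK : ∀ D u, P D u → Disjoint K D := by
    intro D u hD
    have hDr := t.remnant_left D u hD
    rw [Finset.disjoint_left]
    intro y hyK
    refine within_reachable_induction (C := fun y => y ∉ D) ((hmemK y).1 hyK) ?_ ?_
    · exact fun hvD => Finset.notMem_erase v M (hDr.subset hvD)
    · intro a b ha hab haM hbM hbD
      by_cases hav : a = v
      · subst hav
        exact t.not_adj hG hconn hpq hne hD hbD hab
      · exact ha (hDr.closed b hbD a (Finset.mem_erase.2 ⟨hav, haM⟩) hab.symm)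
  have hvD : v ∈ K.erase x := Finset.mem_erase.2 ⟨hxv.symm, hvK⟩
  have hnew : Remnant G p (M.erase x) (K.erase x) x := by
    refine ⟨Finset.erase_subset_erase x hKM, ?_, ?_, ?_, ?_⟩
    · have hvy : ∀ y ∈ K.erase x, (within G (K.erase x)).Reachable v y := by
        intro y hy
        rw [Finset.mem_erase, hmemK] at hy
        refine (within_reachable_induction
          (C := fun y => y ∈ K.erase x ∧ (within G (K.erase x)).Reachable v y)
          (hconx y hy.2 hy.1) ⟨hvD, SimpleGraph.Reachable.refl _⟩ ?_).2
        intro a b ha hab _ hb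
        rw [Finset.mem_erase] at hb
        have hbD : b ∈ K.erase x :=
          Finset.mem_erase.2 ⟨hb.1, hclosed a (Finset.mem_of_mem_erase ha.1) b hb.2 hab⟩
        exact ⟨hbD, ha.2.trans (within_reachable_of_adj hab ha.1 hbD)⟩
      exact fun a ha b hb => (hvy a ha).symm.trans (hvy b hb)
    · intro d hd
      rw [← degOn_eq_erase (hKM hxK)]
      exact h.degOn_eq_of_reachable hG ((hmemK d).1 (Finset.mem_of_mem_erase hd))
    · rw [degOn_erase_self, ← Nat.succ_le_iff, Nat.succ_eq_add_one, ← hx.degOn_eq hG]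
      refine Finset.card_le_card fun y hy => ?_
      rw [Finset.mem_filter] at hy ⊢
      exact ⟨hclosed x hxK y hy.1 hy.2, hy.2⟩
    · intro d hd a ha hda
      rw [Finset.mem_erase] at ha hd ⊢
      exact ⟨ha.1, hclosed d hd.2 a ha.2 hda⟩
  refine ⟨x, K.erase x, ⟨v, hvD⟩, ?_, hx.flip, ?_, ?_, ?_, ?_⟩
  · rintro D' u' (hD' | hD')
    · exact (hPK D' u' hD').mono_left (Finset.erase_subset _ _)
    · refine Finset.disjoint_left.2 fun y hy hyD' => ?_
      exact Finset.mem_compl.1 ((t.remnant_right D' u' hD').subset hyD')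
        (hKM (Finset.mem_of_mem_erase hy))
  · rw [erase_insert_compl (hKM hxK)]
    exact t.remnant_right
  · rw [compl_insert_compl]
    rintro D u (hD | ⟨rfl, rfl⟩)
    · have hDr := t.remnant_left D u hD
      have hdisj := Finset.disjoint_right.1 (hPK D u hD)
      have hnot : ∀ d ∈ D, ∀ k ∈ K, ¬ G.Adj d k := fun d hd k hk hdk =>
        hdisj hd (hclosed k hk d (Finset.mem_of_mem_erase (hDr.subset hd)) hdk.symm)
      refine ⟨fun d hd => Finset.mem_erase.2 ⟨?_, Finset.mem_of_mem_erase (hDr.subset hd)⟩,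
        hDr.connected, fun d hd => ?_, hDr.lt_degOn, fun d hd a ha hda => ?_⟩
      · rintro rfl
        exact hdisj hd hxK
      · rw [← hDr.degOn_eq d hd]
        have h1 := degOn_eq_erase (G := G) h.mem d
        have h2 := degOn_eq_erase (G := G) (hKM hxK) d
        rw [if_neg (hnot d hd v hvK)] at h1
        rw [if_neg (hnot d hd x hxK)] at h2
        omega
      · refine hDr.closed d hd a (Finset.mem_erase.2 ⟨?_, Finset.mem_of_mem_erase ha⟩) hda
        rintro rfl
        exact hnot d hd a hvK hda
    · exact hnew
  · intro D u hD
    obtain rfl | ⟨D', u', hD', hlink⟩ := t.linked_right D u hD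
    · refine ⟨K.erase x, x, Or.inr ⟨rfl, rfl⟩, hvD, fun hux d hd hdu => ?_⟩
      have hd' := (hmemK d).1 (Finset.mem_of_mem_erase hd)
      refine ⟨(hdom hux d hd' hdu).symm, fun e he hde => hne ?_⟩
      exact h.eq_top hG hconn (t.remnant_right D u hD) (hdom hux) hd' hdu he hde
    · exact ⟨D', u', Or.inl hD', hlink⟩
  · rintro D u (hD | ⟨rfl, rfl⟩)
    · exact Or.inr (t.linked_left D u hD)
    · exact Or.inl rfl

/-- A hole that can move on forever would visit more vertices than there are. -/
lemma Trail.false (t : Trail G p q M v P R) (hG : Obstructed G p q) (hconn : G.Connected)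
    (hpq : 1 ≤ p + q) (hne : G ≠ ⊤) : False := by
  suffices h : ∀ n p q M v P R, ∀ W : Finset V, Obstructed G p q → 1 ≤ p + q →
      Trail G p q M v P R → (∀ w ∈ W, ∃ D u, (P D u ∨ R D u) ∧ w ∈ D) → n = Wᶜ.card → False from
    h _ p q M v P R ∅ hG hpq t (by simp) rfl
  intro n
  induction n using Nat.strong_induction_on with
  | _ n ih =>
    intro p q M v P R W hG hpq t hW hn
    obtain ⟨x, D, ⟨d, hd⟩, hdisj, t'⟩ := t.exists_extend hG hconn hpq hne
    have hdW : d ∉ W := by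
      intro hdW
      obtain ⟨D', u', hD', hdD'⟩ := hW d hdW
      exact Finset.disjoint_left.1 (hdisj D' u' hD') hd hdD'
    refine ih _ ?_ q p _ x _ _ (insert d W) hG.symm (by omega) t' ?_ rfl
    · rw [hn, Finset.compl_insert]
      exact Finset.card_erase_lt_of_mem (Finset.mem_compl.2 hdW)
    · intro w hw
      obtain rfl | hw := Finset.mem_insert.1 hw
      · exact ⟨D, x, Or.inr (Or.inr ⟨rfl, rfl⟩), hd⟩
      · obtain ⟨D', u', hD', hwD'⟩ := hW w hw
        exact ⟨D', u', by tauto, hwD'⟩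

/-- A connected graph minus a vertex is degenerate. -/
lemma degenerateOn_compl_singleton (hconn : G.Connected) {n : ℕ}
    (hdeg : ∀ v, G.degree v ≤ n + 1) (v : V) : DegenerateOn G {v}ᶜ n := by
  rintro B hB ⟨b, hb⟩
  by_contra! hlt
  have hBv : v ∉ B := fun h => by simpa using hB h
  have hclosed : ∀ a ∈ B, ∀ c, G.Adj a c → c ∈ B := by
    intro a ha c hac
    by_contra hc
    have h1 : n < degOn G B a := hlt a ha
    have h2 := degOn_add_degOn_compl (G := G) B a
    have h3 : 0 < degOn G Bᶜ a :=
      Finset.card_pos.2 ⟨c, Finset.mem_filter.2 ⟨Finset.mem_compl.2 hc, hac⟩⟩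
    have := hdeg a
    omega
  obtain ⟨w⟩ := hconn.preconnected b v
  refine hBv ?_
  clear hBv hB
  induction w with
  | nil => exact hb
  | cons hadj _ ih => exact ih (hclosed _ hb _ hadj)

/-- A connected incomplete graph of maximum degree at most `p + q + 2` can be partitioned into
a `p`-degenerate and a `q`-degenerate set. -/
lemma exists_bipartition (hconn : G.Connected) (hne : G ≠ ⊤) (hpq : 1 ≤ p + q)
    (hdeg : ∀ v, G.degree v ≤ p + q + 2) :
    ∃ A : Finset V, DegenerateOn G A p ∧ DegenerateOn G Aᶜ q := by
  by_contra! hno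
  have hG : Obstructed G p q := ⟨hdeg, hno⟩
  obtain ⟨v⟩ := hconn.nonempty
  obtain ⟨c, -, hc⟩ := (degenerateOn_compl_singleton hconn (n := p + q + 1) hdeg v).exists_split
    (fun b => bif b then p else q) Finset.univ (by simp; omega)
  set A := ({v}ᶜ : Finset V).filter (fun u => c u = true) with hA
  have hvA : v ∉ A := by simp [hA]
  have hole : IsHole G p q (insert v A) v := by
    refine ⟨Finset.mem_insert_self _ _, ?_, ?_⟩
    · rw [Finset.erase_insert hvA]
      exact hc true
    · refine (hc false).mono fun u hu => ?_
      simp only [hA, Finset.mem_compl, Finset.mem_insert, Finset.mem_filter,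
        Finset.mem_singleton, not_or, not_and] at hu ⊢
      exact ⟨hu.1, by simpa using hu.2 hu.1⟩
  have t : Trail G p q (insert v A) v (fun _ _ => False) (fun _ _ => False) :=
    ⟨hole, by simp, by simp, by simp, by simp⟩
  exact t.false hG hconn hpq hne

end Hole

end DegeneratePartition

/-- Existence content of the paper's main theorem: a non-complete connected graph
with maximum degree `Δ ≥ 3` admits, for any `s ≥ 2` and non-negative `p i` with
`∑ p i ≥ Δ - s`, a vertex partition into sets `A i` with `G[A i]` `p i`-degenerate. -/
theorem partition_into_degenerate_graphs {V : Type*} [Fintype V] [DecidableEq V]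
    (G : SimpleGraph V) [DecidableRel G.Adj]
    (hconn : G.Connected) (hΔ : 3 ≤ G.maxDegree) (hnc : G ≠ ⊤)
    (s : ℕ) (hs : 2 ≤ s) (p : Fin s → ℕ)
    (hp : (G.maxDegree : ℤ) - (s : ℤ) ≤ ∑ i, (p i : ℤ)) :
    ∃ A : Fin s → Finset V,
      (∀ v : V, ∃! i, v ∈ A i) ∧
      (∀ i, DegenerateOn G (A i) (p i)) := by
  let i₀ : Fin s := ⟨0, by omega⟩
  let J : Finset (Fin s) := Finset.univ.erase i₀
  have hsum : p i₀ + 1 + ∑ i ∈ J, (p i + 1) = (∑ i, p i) + s := by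
    rw [Finset.add_sum_erase _ (fun i => p i + 1) (Finset.mem_univ i₀), Finset.sum_add_distrib]
    simp
  have hp' : G.maxDegree ≤ (∑ i, p i) + s := by
    zify
    linarith
  obtain ⟨q, hq⟩ : ∃ q, ∑ i ∈ J, (p i + 1) = q + 1 := by
    refine Nat.exists_eq_add_one.2 (Finset.sum_pos (fun i _ => Nat.succ_pos _) ?_)
    exact ⟨⟨1, by omega⟩, Finset.mem_erase.2 ⟨by simp [i₀], Finset.mem_univ _⟩⟩
  obtain ⟨B, hB, hBc⟩ := DegeneratePartition.exists_bipartition (p := p i₀) (q := q) hconn hnc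
    (by omega) (fun v => (G.degree_le_maxDegree v).trans (by omega))
  obtain ⟨c, hcJ, hc⟩ := hBc.exists_split p J (by omega)
  refine ⟨fun i => if i = i₀ then B else Bᶜ.filter (fun v => c v = i), fun v => ?_, fun i => ?_⟩
  · by_cases hv : v ∈ B
    · refine ⟨i₀, by simpa using hv, fun i hi => ?_⟩
      by_contra hne
      simp [hne, hv] at hi
    · have hcv := (Finset.mem_erase.1 (hcJ v (Finset.mem_compl.2 hv))).1
      refine ⟨c v, by simp [hcv, hv], fun i hi => ?_⟩
      by_cases hi₀ : i = i₀
      · simp [hi₀, hv] at hi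
      · simp [hi₀, hv] at hi
        exact hi.symm
  · by_cases hi₀ : i = i₀
    · simpa [hi₀] using hB
    · simpa [hi₀] using hc i
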